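/- The 3-graph H = (V,E) with V = {1,2,3,4,5,6} and E = {{1,2,3},{1,2,4},{1,2,5},{1,3,4},{2,3,6},{2,5,6},{3,4,6},{3,5,6}} is a saturated 3-forest: for every 3-element subset e' of V with e' ∉ E, the 3-graph (V, E ∪ {e'}) is not a 3-forest. -/

import Mathlib

/-- A surjective `t`-coloring of the vertex set `Vs` with colors `{1, ..., t}`:
the image of `Vs` under `c` is exactly `{1, ..., t}`. -/
def IsColoring (Vs : Finset ℕ) (t : ℕ) (c : ℕ → ℕ) : Prop :=
  Vs.image c = Finset.Icc 1 t

/-- A `k`-graph `(Vs, E)` is a *`k`-forest* if for every edge `e ∈ E` there is a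
surjective `k`-coloring of `Vs` under which `e` is the only rainbow edge
(an edge `f` is rainbow under `c` if `|c(f)| = k`). -/
def IsForest (Vs : Finset ℕ) (k : ℕ) (E : Finset (Finset ℕ)) : Prop :=
  ∀ e ∈ E, ∃ c : ℕ → ℕ, IsColoring Vs k c ∧
    ∀ f ∈ E, ((f.image c).card = k ↔ f = e)

/-- The vertex set `V = {1, 2, 3, 4, 5, 6}`. -/
def V6 : Finset ℕ := {1, 2, 3, 4, 5, 6}

/-- The edge set
`E = {{1,2,3}, {1,2,4}, {1,2,5}, {1,3,4}, {2,3,6}, {2,5,6}, {3,4,6}, {3,5,6}}`. -/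
def E8 : Finset (Finset ℕ) :=
  {{1, 2, 3}, {1, 2, 4}, {1, 2, 5}, {1, 3, 4}, {2, 3, 6}, {2, 5, 6}, {3, 4, 6}, {3, 5, 6}}

theorem rainbow_iff (c : ℕ → ℕ) (x y z : ℕ) :
    ((({x, y, z} : Finset ℕ).image c).card = 3) ↔ (c x ≠ c y ∧ c x ≠ c z ∧ c y ≠ c z) := by
  rw [Finset.image_insert, Finset.image_insert, Finset.image_singleton]
  generalize c x = a
  generalize c y = b
  generalize c z = d
  by_cases h1 : a = b <;> by_cases h2 : a = d <;> by_cases h3 : b = d <;>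
    simp_all [Finset.card_insert_of_notMem]

theorem color_range {c : ℕ → ℕ} (h : IsColoring V6 3 c) {n : ℕ} (hn : n ∈ V6) :
    c n = 1 ∨ c n = 2 ∨ c n = 3 := by
  have h1 : c n ∈ V6.image c := Finset.mem_image_of_mem c hn
  rw [h, Finset.mem_Icc] at h1
  omega

/-- Up to renaming colors, the coloring isolating `{1,2,3}` is unique. -/
theorem coloring_123 {c : ℕ → ℕ} (h : IsColoring V6 3 c)
    (hc : ∀ f ∈ E8, ((f.image c).card = 3 ↔ f = {1, 2, 3})) :
    c 4 = c 1 ∧ c 5 = c 2 ∧ c 6 = c 3 := by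
  have r1 := color_range h (n := 1) (by decide)
  have r2 := color_range h (n := 2) (by decide)
  have r3 := color_range h (n := 3) (by decide)
  have r4 := color_range h (n := 4) (by decide)
  have r5 := color_range h (n := 5) (by decide)
  have r6 := color_range h (n := 6) (by decide)
  have e1 := (rainbow_iff c 1 2 3).1 ((hc {1, 2, 3} (by decide)).2 rfl)
  have e2 := mt (rainbow_iff c 1 2 4).2 (mt (hc {1, 2, 4} (by decide)).1 (by decide))
  have e3 := mt (rainbow_iff c 1 2 5).2 (mt (hc {1, 2, 5} (by decide)).1 (by decide))
  have e4 := mt (rainbow_iff c 1 3 4).2 (mt (hc {1, 3, 4} (by decide)).1 (by decide))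
  have e5 := mt (rainbow_iff c 2 3 6).2 (mt (hc {2, 3, 6} (by decide)).1 (by decide))
  have e6 := mt (rainbow_iff c 2 5 6).2 (mt (hc {2, 5, 6} (by decide)).1 (by decide))
  have e7 := mt (rainbow_iff c 3 4 6).2 (mt (hc {3, 4, 6} (by decide)).1 (by decide))
  have e8 := mt (rainbow_iff c 3 5 6).2 (mt (hc {3, 5, 6} (by decide)).1 (by decide))
  clear hc h
  grind

/-- Up to renaming colors, the coloring isolating `{2,3,6}` is unique. -/
theorem coloring_236 {c : ℕ → ℕ} (h : IsColoring V6 3 c)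
    (hc : ∀ f ∈ E8, ((f.image c).card = 3 ↔ f = {2, 3, 6})) :
    c 1 = c 2 ∧ c 4 = c 3 ∧ c 5 = c 6 := by
  have r1 := color_range h (n := 1) (by decide)
  have r2 := color_range h (n := 2) (by decide)
  have r3 := color_range h (n := 3) (by decide)
  have r4 := color_range h (n := 4) (by decide)
  have r5 := color_range h (n := 5) (by decide)
  have r6 := color_range h (n := 6) (by decide)
  have e1 := (rainbow_iff c 2 3 6).1 ((hc {2, 3, 6} (by decide)).2 rfl)
  have e2 := mt (rainbow_iff c 1 2 4).2 (mt (hc {1, 2, 4} (by decide)).1 (by decide))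
  have e3 := mt (rainbow_iff c 1 2 5).2 (mt (hc {1, 2, 5} (by decide)).1 (by decide))
  have e4 := mt (rainbow_iff c 1 3 4).2 (mt (hc {1, 3, 4} (by decide)).1 (by decide))
  have e5 := mt (rainbow_iff c 1 2 3).2 (mt (hc {1, 2, 3} (by decide)).1 (by decide))
  have e6 := mt (rainbow_iff c 2 5 6).2 (mt (hc {2, 5, 6} (by decide)).1 (by decide))
  have e7 := mt (rainbow_iff c 3 4 6).2 (mt (hc {3, 4, 6} (by decide)).1 (by decide))
  have e8 := mt (rainbow_iff c 3 5 6).2 (mt (hc {3, 5, 6} (by decide)).1 (by decide))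
  clear hc h
  grind

theorem E8_forest : IsForest V6 3 E8 := by
  intro e he
  simp only [E8, Finset.mem_insert, Finset.mem_singleton] at he
  unfold IsColoring
  rcases he with rfl | rfl | rfl | rfl | rfl | rfl | rfl | rfl
  · exact ⟨fun n => [0, 1, 2, 3, 1, 2, 3].getD n 0, by decide, by decide⟩
  · exact ⟨fun n => [0, 1, 2, 1, 3, 1, 1].getD n 0, by decide, by decide⟩
  · exact ⟨fun n => [0, 1, 2, 2, 1, 3, 2].getD n 0, by decide, by decide⟩
  · exact ⟨fun n => [0, 1, 1, 2, 3, 1, 2].getD n 0, by decide, by decide⟩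
  · exact ⟨fun n => [0, 1, 1, 2, 2, 3, 3].getD n 0, by decide, by decide⟩
  · exact ⟨fun n => [0, 1, 1, 2, 1, 3, 2].getD n 0, by decide, by decide⟩
  · exact ⟨fun n => [0, 1, 1, 1, 2, 1, 3].getD n 0, by decide, by decide⟩
  · exact ⟨fun n => [0, 1, 1, 2, 1, 3, 1].getD n 0, by decide, by decide⟩

theorem non_edges : ∀ e ∈ V6.powersetCard 3, e ∉ E8 →
    e = {1, 2, 6} ∨ e = {1, 3, 5} ∨ e = {1, 3, 6} ∨ e = {1, 4, 5} ∨ e = {1, 4, 6} ∨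
    e = {1, 5, 6} ∨ e = {2, 3, 4} ∨ e = {2, 3, 5} ∨ e = {2, 4, 5} ∨ e = {2, 4, 6} ∨
    e = {3, 4, 5} ∨ e = {4, 5, 6} := by
  decide

/-- The 3-graph `(V6, E8)` is a saturated 3-forest: it is a 3-forest, and for every
3-element subset `e'` of `V6` with `e' ∉ E8`, the 3-graph `(V6, E8 ∪ {e'})` is not a
3-forest. -/
theorem E8_saturated :
    IsForest V6 3 E8 ∧
      ∀ e' ⊆ V6, e'.card = 3 → e' ∉ E8 → ¬ IsForest V6 3 (insert e' E8) := by
  refine ⟨E8_forest, fun e' hs hcard hne hF => ?_⟩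
  obtain ⟨c, hc, hcE⟩ := hF {1, 2, 3} (Finset.mem_insert_of_mem (by decide))
  obtain ⟨d, hd, hdE⟩ := hF {2, 3, 6} (Finset.mem_insert_of_mem (by decide))
  have c1 := coloring_123 hc fun f hf => hcE f (Finset.mem_insert_of_mem hf)
  have d1 := coloring_236 hd fun f hf => hdE f (Finset.mem_insert_of_mem hf)
  have c2 := (rainbow_iff c 1 2 3).1
    ((hcE {1, 2, 3} (Finset.mem_insert_of_mem (by decide))).2 rfl)
  have d2 := (rainbow_iff d 2 3 6).1
    ((hdE {2, 3, 6} (Finset.mem_insert_of_mem (by decide))).2 rfl)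
  have c3 : ¬ (e'.image c).card = 3 := fun h =>
    hne ((hcE e' (Finset.mem_insert_self _ _)).1 h ▸ by decide)
  have d3 : ¬ (e'.image d).card = 3 := fun h =>
    hne ((hdE e' (Finset.mem_insert_self _ _)).1 h ▸ by decide)
  have hcases := non_edges e' (Finset.mem_powersetCard.2 ⟨hs, hcard⟩) hne
  clear hcE hdE hF hc hd hs hcard hne
  rcases hcases with rfl | rfl | rfl | rfl | rfl | rfl | rfl | rfl | rfl | rfl | rfl | rfl <;>
    rw [rainbow_iff] at c3 d3 <;> omega
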